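/- With local dimensions d_A = 4 and d_B = 6, the Bell diagonal state ρ_{P^{(1)}} with probability matrix P^{(1)} = (1/10)·[[1,0,1,0,0,0],[1,1,1,0,1,0],[1,0,1,0,0,0],[0,0,0,1,0,1]] has positive semidefinite partial transpose: ρ_{P^{(1)}}^{T_A} ≥ 0. -/

import Mathlib

open Matrix Complex Finset
open scoped Kronecker ComplexOrder

noncomputable section

/-- The primitive `d`-th root of unity `ω = exp(2πi/d)`. -/
def omg (d : ℕ) : ℂ := Complex.exp (2 * Real.pi * Complex.I / d)

/-- The shift operator `X|i⟩ = |i ⊕ 1⟩` (addition mod `d`). -/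
def shiftX (d : ℕ) : Matrix (Fin d) (Fin d) ℂ :=
  Matrix.of fun i j => if (i : ℕ) = ((j : ℕ) + 1) % d then 1 else 0

/-- The clock operator `Z|i⟩ = ω^i |i⟩`. -/
def clockZ (d : ℕ) : Matrix (Fin d) (Fin d) ℂ :=
  Matrix.diagonal fun i => omg d ^ (i : ℕ)

/-- The modified clock operator on `ℂ^{dA}`, `Ẑ|i⟩ = ω_B^i |i⟩`. -/
def clockZmod (dA dB : ℕ) : Matrix (Fin dA) (Fin dA) ℂ :=
  Matrix.diagonal fun i => omg dB ^ (i : ℕ)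

/-- The generalized Bell state `|φ^{00}⟩ = (1/√dA) ∑ᵢ |i⟩⊗|i⟩`. -/
def bell00 (dA dB : ℕ) : Fin dA × Fin dB → ℂ :=
  fun p => if (p.2 : ℕ) = (p.1 : ℕ) then ((1 / Real.sqrt dA : ℝ) : ℂ) else 0

/-- The generalized Bell state `|φ^{αβ}⟩ = (Z_A^α ⊗ X_B^β)|φ^{00}⟩`. -/
def bell (dA dB : ℕ) (α β : ℕ) : Fin dA × Fin dB → ℂ :=
  Matrix.mulVec ((clockZ dA ^ α) ⊗ₖ (shiftX dB ^ β)) (bell00 dA dB)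

/-- The outer product `|v⟩⟨v|`. -/
def outer {n : Type*} [Fintype n] (v : n → ℂ) : Matrix n n ℂ :=
  Matrix.of fun i j => v i * (starRingEnd ℂ) (v j)

/-- The Bell diagonal state `ρ_P = ∑_{αβ} p_{αβ} |φ^{αβ}⟩⟨φ^{αβ}|`. -/
def rhoBDS (dA dB : ℕ) (p : Fin dA → Fin dB → ℝ) :
    Matrix (Fin dA × Fin dB) (Fin dA × Fin dB) ℂ :=
  ∑ α : Fin dA, ∑ β : Fin dB, (p α β : ℂ) • outer (bell dA dB (α : ℕ) (β : ℕ))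

/-- The Fourier coefficients `λ_{μν} = ∑_{αβ} p_{αβ} ω_A^{αμ} ω_B^{βν}`. -/
def lam (dA dB : ℕ) (p : Fin dA → Fin dB → ℝ) (μ ν : ℕ) : ℂ :=
  ∑ α : Fin dA, ∑ β : Fin dB,
    (p α β : ℂ) * omg dA ^ ((α : ℕ) * μ) * omg dB ^ ((β : ℕ) * ν)

/-- The partial transpose on subsystem `A`: `⟨ij|ρ^{T_A}|kl⟩ = ⟨kj|ρ|il⟩`. -/
def ptA {dA dB : ℕ} (ρ : Matrix (Fin dA × Fin dB) (Fin dA × Fin dB) ℂ) :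
    Matrix (Fin dA × Fin dB) (Fin dA × Fin dB) ℂ :=
  Matrix.of fun p q => ρ (q.1, p.2) (p.1, q.2)

/-- A bipartite density matrix is separable if it is a finite convex combination of
tensor products of density matrices. -/
def IsSepState {dA dB : ℕ} (σ : Matrix (Fin dA × Fin dB) (Fin dA × Fin dB) ℂ) : Prop :=
  ∃ (n : ℕ) (q : Fin n → ℝ) (a : Fin n → Matrix (Fin dA) (Fin dA) ℂ)
    (b : Fin n → Matrix (Fin dB) (Fin dB) ℂ),
    (∀ i, 0 ≤ q i) ∧ (∑ i, q i = 1) ∧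
    (∀ i, (a i).PosSemidef ∧ (a i).trace = 1) ∧
    (∀ i, (b i).PosSemidef ∧ (b i).trace = 1) ∧
    σ = ∑ i, (q i : ℂ) • (a i ⊗ₖ b i)

/-- The local unitaries `T(μ,ν) = X_A^μ Ẑ^ν ⊗ X_B^μ Z_B^{-ν}`. -/
def Tgate (dA dB : ℕ) (μ ν : ℕ) : Matrix (Fin dA × Fin dB) (Fin dA × Fin dB) ℂ :=
  (shiftX dA ^ μ * clockZmod dA dB ^ ν) ⊗ₖ (shiftX dB ^ μ * (clockZ dB ^ ν)ᴴ)

/-- The map `Φ_q(ρ) = (1-q)ρ + (q/(dA dB)) ∑_{μν} T(μ,ν) ρ T(μ,ν)†`. -/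
def Phi (dA dB : ℕ) (q : ℝ) (ρ : Matrix (Fin dA × Fin dB) (Fin dA × Fin dB) ℂ) :
    Matrix (Fin dA × Fin dB) (Fin dA × Fin dB) ℂ :=
  (1 - (q : ℂ)) • ρ + ((q : ℂ) / (dA * dB)) •
    ∑ μ : Fin dA, ∑ ν : Fin dB, Tgate dA dB (μ : ℕ) (ν : ℕ) * ρ * (Tgate dA dB (μ : ℕ) (ν : ℕ))ᴴ


/-- The probability matrix `P⁽¹⁾` from Eq. (29) of the paper. -/
def pP1 : Fin 4 → Fin 6 → ℝ := fun α β =>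
  (1 / 10) * !![1,0,1,0,0,0; 1,1,1,0,1,0; 1,0,1,0,0,0; 0,0,0,1,0,1] α β

theorem shiftX_pow_apply (d β : ℕ) (i j : Fin d) :
    (shiftX d ^ β) i j = if (i : ℕ) = ((j : ℕ) + β) % d then 1 else 0 := by
  induction β generalizing j with
  | zero => simp [Matrix.one_apply, Nat.mod_eq_of_lt j.isLt, Fin.ext_iff]
  | succ n ih =>
    rw [pow_succ, Matrix.mul_apply]
    have hd : 0 < d := j.pos
    rw [Finset.sum_eq_single ⟨((j : ℕ) + 1) % d, Nat.mod_lt _ hd⟩]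
    · rw [ih]
      simp [shiftX, add_assoc, add_comm 1 n]
    · intro k _ hk
      have hk' : (k : ℕ) ≠ ((j : ℕ) + 1) % d := fun h => hk (Fin.ext h)
      simp [shiftX, hk']
    · simp

theorem bell_apply {dA dB : ℕ} (h : dA ≤ dB) (α β : ℕ) (i : Fin dA) (j : Fin dB) :
    bell dA dB α β (i, j) =
      if (j : ℕ) = ((i : ℕ) + β) % dB then omg dA ^ ((i : ℕ) * α) * ((1 / √dA : ℝ) : ℂ)
      else 0 := by
  simp only [bell, Matrix.mulVec, dotProduct]
  rw [Finset.sum_eq_single (i, ⟨i, i.isLt.trans_le h⟩)]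
  · simp [clockZ, Matrix.diagonal_pow, shiftX_pow_apply, bell00, pow_mul]
  · rintro ⟨k, l⟩ _ hkl
    by_cases hk : i = k
    · subst hk
      have hl : (l : ℕ) ≠ i := fun hl => hkl (Prod.ext rfl (Fin.ext hl))
      simp [bell00, hl]
    · simp [clockZ, Matrix.diagonal_pow, Matrix.diagonal_apply_ne _ hk]
  · simp

theorem omg_four : omg 4 = Complex.I := by
  refine (congrArg Complex.exp ?_).trans Complex.exp_pi_div_two_mul_I
  push_cast
  ring

theorem outer_posSemidef {n : Type*} [Fintype n] (v : n → ℂ) : (outer v).PosSemidef :=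
  Matrix.posSemidef_vecMulVec_self_star v

/-- Twice the Bell states of `ℂ⁴ ⊗ ℂ⁶`, with Gaussian integer entries. -/
def gaussBell (α : Fin 4) (β : Fin 6) (i : Fin 4) (j : Fin 6) : GaussianInt :=
  if (j : ℕ) = ((i : ℕ) + β) % 6 then ⟨0, 1⟩ ^ ((i : ℕ) * α) else 0

theorem bell_four_six (α : Fin 4) (β : Fin 6) (i : Fin 4) (j : Fin 6) :
    bell 4 6 α β (i, j) = (1 / 2) * (gaussBell α β i j).toComplex := by
  have hs : √((4 : ℕ) : ℝ) = 2 := by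
    rw [show ((4 : ℕ) : ℝ) = 2 ^ 2 by norm_num, Real.sqrt_sq (by norm_num)]
  rw [bell_apply (by norm_num), hs, omg_four, gaussBell]
  split_ifs
  · rw [map_pow, GaussianInt.toComplex_def']
    simp [mul_comm]
  · simp

/-- Ten times the probability matrix `pP1`. -/
def pP1Num : Fin 4 → Fin 6 → ℤ :=
  !![1,0,1,0,0,0; 1,1,1,0,1,0; 1,0,1,0,0,0; 0,0,0,1,0,1]

theorem pP1_eq (α : Fin 4) (β : Fin 6) : pP1 α β = (1 / 10) * (pP1Num α β : ℝ) := by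
  fin_cases α <;> fin_cases β <;> simp [pP1, pP1Num]

/-- Coefficients on the first factor of the vectors decomposing the partial transpose. -/
def ptVecCoeff : Fin 12 → Fin 4 → GaussianInt :=
  !![⟨0, -1⟩, 1, ⟨0, 1⟩, 1;
     1, ⟨0, -1⟩, -1, ⟨0, 1⟩;
     1, ⟨0, -1⟩, 1, ⟨0, 1⟩;
     1, ⟨0, -1⟩, -1, ⟨0, 1⟩;
     1, ⟨0, 1⟩, 1, ⟨0, 1⟩;
     1, ⟨0, -1⟩, -1, ⟨0, 1⟩;
     1, 0, 0, ⟨0, -1⟩;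
     0, 0, 1, 0;
     1, 0, 0, ⟨0, -1⟩;
     0, 1, 0, 0;
     0, 1, 0, 0;
     0, 0, 1, 0]

/-- The value of `i + j` modulo `6` on which each decomposing vector is supported. -/
def ptVecSupport : Fin 12 → ℕ := ![0, 1, 2, 3, 4, 5, 0, 0, 2, 2, 4, 4]

/-- The weights of the decomposition of the partial transpose. -/
def ptVecWeight : Fin 12 → ℕ := ![1, 1, 1, 1, 1, 1, 2, 2, 2, 2, 2, 2]

/-- The vectors decomposing the partial transpose. -/
def ptVec (k : Fin 12) (p : Fin 4 × Fin 6) : GaussianInt :=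
  if ((p.1 : ℕ) + p.2) % 6 = ptVecSupport k then ptVecCoeff k p.1 else 0

theorem gaussBell_sum_eq : ∀ p q : Fin 4 × Fin 6,
    ∑ α : Fin 4, ∑ β : Fin 6,
      (pP1Num α β : GaussianInt) * (gaussBell α β q.1 p.2 * star (gaussBell α β p.1 q.2)) =
    ∑ k : Fin 12, (ptVecWeight k : GaussianInt) * (ptVec k p * star (ptVec k q)) := by
  decide +kernel

theorem ptA_rhoBDS_pP1_eq :
    ptA (rhoBDS 4 6 pP1) =
      ∑ k : Fin 12, ((ptVecWeight k : ℝ) / 40) • outer fun p => (ptVec k p).toComplex := by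
  ext p q
  have h := congrArg GaussianInt.toComplex (gaussBell_sum_eq p q)
  simp only [map_sum, map_mul, map_intCast, map_natCast, GaussianInt.toComplex_star] at h
  simp only [ptA, rhoBDS, outer, Matrix.of_apply, Matrix.sum_apply, Matrix.smul_apply,
    bell_four_six, pP1_eq, smul_eq_mul, Complex.real_smul]
  calc _ = (1 / 40 : ℂ) * _ := ?_
    _ = (1 / 40 : ℂ) * _ := congrArg _ h
    _ = _ := ?_
  · simp only [Finset.mul_sum]
    refine Finset.sum_congr rfl fun α _ => Finset.sum_congr rfl fun β _ => ?_
    simp only [map_mul, map_div₀, map_one, map_ofNat]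
    push_cast
    ring
  · rw [Finset.mul_sum]
    refine Finset.sum_congr rfl fun k _ => ?_
    push_cast
    ring

/-- The `4 × 6` Bell diagonal state `ρ_{P⁽¹⁾}` has positive
semidefinite partial transpose. -/
theorem pP1_ppt : (ptA (rhoBDS 4 6 pP1)).PosSemidef := by
  rw [ptA_rhoBDS_pP1_eq]
  exact Matrix.posSemidef_sum _ fun k _ => (outer_posSemidef _).smul (by positivity)

end
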